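/- For m = 3, M = 1, and every α ∈ (0,1], the tRPM transition kernel gives every partition strictly larger probability of persisting than it has under the CRP: for every partition ρ of {1,2,3}, K_α(ρ, ρ) > p_3(ρ). -/

import Mathlib

open Finset

noncomputable section

/-- CRP(M) probability of a partition of a finite set `s` of `n = s.card` elements:
`p_n(ρ) = M^k ∏_j (|S_j| - 1)! / ∏_{i=1}^n (M + i - 1)`. -/
def crp {α : Type*} [DecidableEq α] (M : ℝ) {s : Finset α} (P : Finpartition s) : ℝ :=
  (M ^ P.parts.card * ∏ b ∈ P.parts, (Nat.factorial (b.card - 1) : ℝ)) /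
    ∏ i ∈ Finset.range s.card, (M + i)

/-- Restriction of a partition of `s` to a subset `A ⊆ s`: the clusters are the
nonempty intersections of the clusters with `A`. -/
def restrictPart {α : Type*} [DecidableEq α] {s : Finset α} (P : Finpartition s)
    (A : Finset α) (hA : A ⊆ s) : Finpartition A :=
  Finpartition.ofErase (P.parts.image (· ∩ A))
    (by
      rw [Finset.supIndep_iff_pairwiseDisjoint]
      rintro x hx y hy hxy
      simp only [coe_image, Set.mem_image, mem_coe] at hx hy
      obtain ⟨p, hp, rfl⟩ := hx
      obtain ⟨q, hq, rfl⟩ := hy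
      have hpq : p ≠ q := by rintro rfl; exact hxy rfl
      exact (P.disjoint hp hq hpq).mono inter_subset_left inter_subset_left)
    (by
      rw [Finset.sup_image]
      have : (P.parts.sup (id ∘ (· ∩ A))) = P.parts.sup id ⊓ A := by
        rw [Finset.sup_inf_distrib_right]
        rfl
      rw [this, P.sup_parts]
      exact inf_eq_right.mpr hA)

/-- The set `S(γ) = {i : γ i = 1}`. -/
def gammaSet {m : ℕ} (γ : Fin m → Bool) : Finset (Fin m) :=
  Finset.univ.filter (fun i => γ i = true)

/-- The one-step tRPM transition kernel `K_α(ρ, λ)`. -/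
def tK {m : ℕ} (M a : ℝ) (ρ lam : Finpartition (Finset.univ : Finset (Fin m))) : ℝ :=
  ∑ γ : Fin m → Bool,
    (∏ i, if γ i then a else 1 - a) *
      (if restrictPart lam (gammaSet γ) (Finset.subset_univ _) =
          restrictPart ρ (gammaSet γ) (Finset.subset_univ _) then 1 else 0) *
      (crp M lam / crp M (restrictPart lam (gammaSet γ) (Finset.subset_univ _)))

end


lemma crp_den (n : ℕ) : ∏ i ∈ Finset.range n, ((1 : ℝ) + i) = (n.factorial : ℝ) := by
  rw [← Finset.prod_range_add_one_eq_factorial]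
  push_cast
  exact Finset.prod_congr rfl fun i _ => add_comm _ _

lemma crp_eq {α : Type*} [DecidableEq α] {s : Finset α} (P : Finpartition s) :
    crp (1 : ℝ) P = ((∏ b ∈ P.parts, Nat.factorial (b.card - 1) : ℕ) : ℝ) /
      (s.card.factorial : ℝ) := by
  unfold crp
  rw [crp_den]
  simp

lemma crp_pos {α : Type*} [DecidableEq α] {s : Finset α} (P : Finpartition s) :
    0 < crp (1 : ℝ) P := by
  rw [crp_eq]
  have : 0 < ∏ b ∈ P.parts, Nat.factorial (b.card - 1) :=
    Finset.prod_pos fun b _ => Nat.factorial_pos _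
  have h2 := Nat.factorial_pos s.card
  positivity

lemma num_le {α : Type*} [DecidableEq α] {s : Finset α} (P : Finpartition s) :
    ∏ b ∈ P.parts, Nat.factorial (b.card - 1) ≤ (∑ b ∈ P.parts, (b.card - 1)).factorial :=
  Nat.le_of_dvd (Nat.factorial_pos _) (Nat.prod_factorial_dvd_factorial_sum _ _)

lemma crp_le_one {α : Type*} [DecidableEq α] {s : Finset α} (P : Finpartition s) :
    crp (1 : ℝ) P ≤ 1 := by
  rw [crp_eq]
  have h2 := Nat.factorial_pos s.card
  rw [div_le_one (by exact_mod_cast h2)]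
  have h : ∑ b ∈ P.parts, (b.card - 1) ≤ s.card := by
    rw [← P.sum_card_parts]
    exact Finset.sum_le_sum fun b _ => Nat.sub_le _ _
  exact_mod_cast (num_le P).trans (Nat.factorial_le h)

lemma crp_lt_one (P : Finpartition (Finset.univ : Finset (Fin 3))) :
    crp (1 : ℝ) P < 1 := by
  rw [crp_eq]
  have h2 := Nat.factorial_pos (Finset.univ : Finset (Fin 3)).card
  rw [div_lt_one (by exact_mod_cast h2)]
  have hs : ∑ b ∈ P.parts, b.card = 3 := by simpa using P.sum_card_parts
  have hne : P.parts.Nonempty := by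
    rw [Finset.nonempty_iff_ne_empty]
    intro h
    simp [h] at hs
  have h : ∑ b ∈ P.parts, (b.card - 1) < ∑ b ∈ P.parts, b.card :=
    Finset.sum_lt_sum_of_nonempty hne fun b hb =>
      Nat.sub_lt (Finset.card_pos.mpr (P.nonempty_of_mem_parts hb)) one_pos
  have h3 : ∑ b ∈ P.parts, (b.card - 1) ≤ 2 := by omega
  have h4 := (num_le P).trans (Nat.factorial_le h3)
  have h5 : ∏ b ∈ P.parts, Nat.factorial (b.card - 1) <
      (Finset.univ : Finset (Fin 3)).card.factorial := lt_of_le_of_lt h4 (by decide)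
  exact_mod_cast h5

lemma restrict_full {m : ℕ} (P : Finpartition (Finset.univ : Finset (Fin m)))
    (A : Finset (Fin m)) (hA : A = Finset.univ) :
    crp (1 : ℝ) (restrictPart P A (Finset.subset_univ _)) = crp (1 : ℝ) P := by
  subst hA
  congr 1
  ext b
  simp only [restrictPart, Finpartition.ofErase, Finset.inter_univ, Finset.image_id',
    Finset.bot_eq_empty, Finset.mem_erase]
  exact ⟨fun h => h.2, fun h => ⟨(P.nonempty_of_mem_parts h).ne_empty, h⟩⟩

/-- for `m = 3`, `M = 1` and every `α ∈ (0,1]`, the tRPM kernel gives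
every partition strictly larger probability of persisting than it has under the CRP:
`K_α(ρ, ρ) > p_3(ρ)` for every partition `ρ` of `{1,2,3}`. -/
theorem statement19 (a : ℝ) (ha : a ∈ Set.Ioc (0 : ℝ) 1)
    (ρ : Finpartition (Finset.univ : Finset (Fin 3))) :
    tK 1 a ρ ρ > crp (1 : ℝ) ρ := by
  obtain ⟨h0, h1⟩ := ha
  have hw : ∑ γ : Fin 3 → Bool, (∏ i, if γ i then a else 1 - a) = 1 := by
    have := (Finset.prod_univ_sum (fun _ : Fin 3 => (Finset.univ : Finset Bool))
      (fun _ b => if b then a else 1 - a)).symm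
    rw [Fintype.piFinset_univ] at this
    rw [this]
    simp
  have hlhs : crp (1 : ℝ) ρ =
      ∑ γ : Fin 3 → Bool, (∏ i, if γ i then a else 1 - a) * crp (1 : ℝ) ρ := by
    rw [← Finset.sum_mul, hw, one_mul]
  unfold tK
  simp only [if_true, mul_one]
  rw [gt_iff_lt]
  conv_lhs => rw [hlhs]
  apply Finset.sum_lt_sum
  · intro γ _
    apply mul_le_mul_of_nonneg_left
    · exact le_div_self (crp_pos _).le (crp_pos _) (crp_le_one _)
    · refine Finset.prod_nonneg fun i _ => ?_
      split_ifs <;> linarith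
  · refine ⟨fun _ => true, Finset.mem_univ _, ?_⟩
    rw [restrict_full ρ _ (by simp [gammaSet]), div_self (crp_pos ρ).ne']
    apply mul_lt_mul_of_pos_left (crp_lt_one ρ)
    exact Finset.prod_pos fun i _ => by simpa using h0
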